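/- Suppose the stability discriminant satisfies Ξ < 1 and M̄₃ ≠ 0. Then for all w ∈ H¹₀(Ω)³, ‖w‖²₀ + ‖M̄·∇w‖²₀ + ‖div w‖²₀ ≲ -E(w), where E(w) := g⟦ρ̄⟧∫_Σ w₃² + ∫_Ω (gρ̄' w₃² + 2gρ̄ div w · w₃ - P'(ρ̄)ρ̄ |div w|²) dy - λ‖div w M̄ - M̄·∇w‖²₀. -/

import Mathlib

open MeasureTheory Real Set

/-- The partial derivative `∂ᵢ f` of a scalar function on `ℝ³`. -/
noncomputable def pd (i : Fin 3) (f : (Fin 3 → ℝ) → ℝ) (x : Fin 3 → ℝ) : ℝ :=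
  fderiv ℝ f x (Pi.single i 1)

/-- `div w` for a vector field on `ℝ³`. -/
noncomputable def divg (w : (Fin 3 → ℝ) → (Fin 3 → ℝ)) (x : Fin 3 → ℝ) : ℝ :=
  ∑ i, pd i (fun y => w y i) x

/-- The `i`-th component of the directional derivative `M̄·∇w` of a vector field. -/
noncomputable def mdir (M : Fin 3 → ℝ) (w : (Fin 3 → ℝ) → (Fin 3 → ℝ)) (i : Fin 3)
    (x : Fin 3 → ℝ) : ℝ :=
  ∑ k, M k * pd k (fun y => w y i) x

/-- The horizontally periodic slab `Ω = 𝕋² × (h₋, h₊)`, realized as one periodicity cell. -/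
def slab (hm hp L₁ L₂ : ℝ) : Set (Fin 3 → ℝ) :=
  {x | x 0 ∈ Ioo 0 (2 * π * L₁) ∧ x 1 ∈ Ioo 0 (2 * π * L₂) ∧ x 2 ∈ Ioo hm hp}

/-- Membership in `H¹₀(Ω)³`: C¹, vanishing on the top and bottom boundary planes,
and horizontally periodic. -/
def memH10 (hm hp L₁ L₂ : ℝ) (w : (Fin 3 → ℝ) → (Fin 3 → ℝ)) : Prop :=
  ContDiff ℝ 1 w ∧ (∀ x : Fin 3 → ℝ, x 2 = hm ∨ x 2 = hp → w x = 0) ∧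
    (∀ x, w (x + (2 * π * L₁) • (Pi.single 0 1 : Fin 3 → ℝ)) = w x) ∧
    (∀ x, w (x + (2 * π * L₂) • (Pi.single 1 1 : Fin 3 → ℝ)) = w x)


lemma kap (k : ℝ → ℝ) (hk : Continuous k) (hm : Monotone k) (h0 : ∀ t ≤ 0, k t = 0) :
    ∃ κ ψ : ℝ → ℝ, Continuous κ ∧ Continuous ψ ∧ κ 0 = 0 ∧ ψ 0 = 0 ∧ (∀ t, 0 ≤ k t ∧ k t ≤ κ t) ∧
      ∀ t, t ≠ 0 → HasDerivAt κ (ψ t / t) t := by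
  have kn : ∀ t, 0 ≤ k t := by
    intro t
    rcases le_total t 0 with h | h
    · rw [h0 t h]
    · rw [← h0 0 le_rfl]; exact hm h
  set κ : ℝ → ℝ := fun r => r⁻¹ * ∫ s in r..2 * r, k s with hκ
  have hd : ∀ t, t ≠ 0 → HasDerivAt κ ((2 * k (2 * t) - k t - κ t) / t) t := by
    intro t ht
    have h1 : ∀ x, HasDerivAt (fun u => ∫ s in (0:ℝ)..u, k s) (k x) x := fun x =>
      (hk.integral_hasStrictDerivAt 0 x).hasDerivAt
    have h2 : HasDerivAt (fun r : ℝ => 2 * r) 2 t := by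
      simpa using (hasDerivAt_id t).const_mul (2:ℝ)
    have h3 := ((h1 (2 * t)).comp t h2).sub (h1 t)
    have h4 : HasDerivAt (fun r => ∫ s in r..2 * r, k s) (k (2 * t) * 2 - k t) t := by
      refine h3.congr_of_eventuallyEq (Filter.Eventually.of_forall fun r => ?_)
      simp only [Function.comp, Pi.sub_apply]
      rw [intervalIntegral.integral_interval_sub_left (hk.intervalIntegrable _ _)
        (hk.intervalIntegrable _ _)]
    have h5 := (hasDerivAt_inv ht).mul h4
    refine h5.congr_deriv ?_
    simp only [hκ]
    field_simp
    ring
  have hb : ∀ t, k t ≤ κ t ∧ κ t ≤ k (2 * t) := by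
    intro t
    rcases le_or_gt t 0 with h | h
    · have : (∫ s in t..2 * t, k s) = ∫ s in t..2 * t, (0:ℝ) := by
        apply intervalIntegral.integral_congr
        intro s hs
        rw [uIcc_of_ge (by linarith)] at hs
        exact h0 s (hs.2.trans h)
      simp only [hκ, this, h0 t h, h0 (2 * t) (by linarith)]
      simp
    · have e1 : (∫ s in t..2 * t, k t) ≤ ∫ s in t..2 * t, k s := by
        apply intervalIntegral.integral_mono_on (by linarith) (by simp) (hk.intervalIntegrable _ _)
        intro x hx; exact hm hx.1
      have e2 : (∫ s in t..2 * t, k s) ≤ ∫ s in t..2 * t, k (2 * t) := by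
        apply intervalIntegral.integral_mono_on (by linarith) (hk.intervalIntegrable _ _) (by simp)
        intro x hx; exact hm hx.2
      rw [intervalIntegral.integral_const, smul_eq_mul] at e1 e2
      simp only [hκ]
      rw [le_inv_mul_iff₀ h, inv_mul_le_iff₀ h]
      constructor <;> nlinarith
  have hc : Continuous κ := by
    rw [continuous_iff_continuousAt]
    intro t
    by_cases ht : t = 0
    · subst ht
      have z : κ 0 = 0 := by simp [hκ]
      unfold ContinuousAt
      rw [z]
      have l1 : Filter.Tendsto k (nhds 0) (nhds 0) := by
        simpa [h0 0 le_rfl] using hk.tendsto 0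
      have l2 : Filter.Tendsto (fun t => k (2 * t)) (nhds 0) (nhds 0) := by
        have : Continuous (fun t => k (2 * t)) := by fun_prop
        simpa [h0 0 le_rfl] using this.tendsto 0
      exact tendsto_of_tendsto_of_tendsto_of_le_of_le l1 l2 (fun t => (hb t).1) (fun t => (hb t).2)
    · exact (hd t ht).continuousAt
  refine ⟨κ, fun t => 2 * k (2 * t) - k t - κ t, hc, by fun_prop, by simp [hκ], by simp [hκ, h0 0 le_rfl],
    fun t => ⟨kn t, (hb t).1⟩, hd⟩

lemma cont_mul_bdd (κ b : ℝ → ℝ) (hκ : Continuous κ) (h0 : κ 0 = 0) (hb : ∀ t, |b t| ≤ 1)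
    (hc : ∀ t, t ≠ 0 → ContinuousAt b t) : Continuous (fun t => κ t * b t) := by
  rw [continuous_iff_continuousAt]
  intro t
  by_cases ht : t = 0
  · subst ht
    unfold ContinuousAt
    simp only [h0, zero_mul]
    have l1 : Filter.Tendsto (fun t => |κ t|) (nhds 0) (nhds 0) := by
      simpa [h0] using hκ.abs.tendsto 0
    refine squeeze_zero_norm (fun t => ?_) l1
    rw [norm_mul, Real.norm_eq_abs, Real.norm_eq_abs]
    exact mul_le_of_le_one_right (abs_nonneg _) (hb t)
  · exact hκ.continuousAt.mul (hc t ht)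

lemma osc (k : ℝ → ℝ) (hk : Continuous k) (hm : Monotone k) (h0 : ∀ t ≤ 0, k t = 0) :
    ∃ f₁ φ₁ f₂ φ₂ : ℝ → ℝ, (Continuous f₁ ∧ Continuous φ₁ ∧ ∀ t, t ≠ 0 → HasDerivAt f₁ (φ₁ t / t) t) ∧
      (Continuous f₂ ∧ Continuous φ₂ ∧ ∀ t, t ≠ 0 → HasDerivAt f₂ (φ₂ t / t) t) ∧
      ∀ t, k t ^ 2 ≤ φ₁ t ^ 2 + φ₂ t ^ 2 := by
  obtain ⟨κ, ψ, hκ, hψ, κ0, ψ0, hb, hd⟩ := kap k hk hm h0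
  have cc : ∀ t : ℝ, t ≠ 0 → ContinuousAt (fun t => cos (log t)) t := fun t ht =>
    Real.continuous_cos.continuousAt.comp (Real.continuousAt_log ht)
  have cs : ∀ t : ℝ, t ≠ 0 → ContinuousAt (fun t => sin (log t)) t := fun t ht =>
    Real.continuous_sin.continuousAt.comp (Real.continuousAt_log ht)
  have bc : ∀ t : ℝ, |cos (log t)| ≤ 1 := fun t => abs_cos_le_one _
  have bs : ∀ t : ℝ, |sin (log t)| ≤ 1 := fun t => abs_sin_le_one _
  refine ⟨fun t => κ t * cos (log t), fun t => ψ t * cos (log t) - κ t * sin (log t),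
    fun t => κ t * sin (log t), fun t => ψ t * sin (log t) + κ t * cos (log t),
    ⟨cont_mul_bdd _ _ hκ κ0 bc cc, (cont_mul_bdd _ _ hψ ψ0 bc cc).sub (cont_mul_bdd _ _ hκ κ0 bs cs), ?_⟩,
    ⟨cont_mul_bdd _ _ hκ κ0 bs cs, (cont_mul_bdd _ _ hψ ψ0 bs cs).add (cont_mul_bdd _ _ hκ κ0 bc cc), ?_⟩, ?_⟩
  · intro t ht
    refine ((hd t ht).mul (Real.hasDerivAt_log ht).cos).congr_deriv ?_
    field_simp
    ring
  · intro t ht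
    refine ((hd t ht).mul (Real.hasDerivAt_log ht).sin).congr_deriv ?_
    field_simp
  · intro t
    have e : (ψ t * cos (log t) - κ t * sin (log t)) ^ 2 + (ψ t * sin (log t) + κ t * cos (log t)) ^ 2
      = (ψ t ^ 2 + κ t ^ 2) * (sin (log t) ^ 2 + cos (log t) ^ 2) := by ring
    rw [Real.sin_sq_add_cos_sq] at e
    have := hb t
    simp only [e]
    nlinarith [sq_nonneg (ψ t)]

lemma contDiff_ff (R : ℝ) (f φ : ℝ → ℝ) (hf : Continuous f) (hφ : Continuous φ)
    (hd : ∀ t, t ≠ 0 → HasDerivAt f (φ t / t) t) : ContDiff ℝ 1 (fun t => t * (R - t) * f t) := by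
  have key : ∀ t, HasDerivAt (fun t => t * (R - t) * f t) ((R - 2 * t) * f t + (R - t) * φ t) t := by
    have h1 : ∀ t, t ≠ 0 → HasDerivAt (fun t => t * (R - t) * f t) ((R - 2 * t) * f t + (R - t) * φ t) t := by
      intro t ht
      have := (((hasDerivAt_id t).mul ((hasDerivAt_id t).const_sub R))).mul (hd t ht)
      refine this.congr_deriv ?_
      simp
      field_simp
      ring
    intro t
    by_cases ht : t = 0
    · subst ht
      exact hasDerivAt_of_hasDerivAt_of_ne (g := fun t => (R - 2 * t) * f t + (R - t) * φ t)
        (fun y hy => h1 y hy) (by fun_prop) (by fun_prop)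
    · exact h1 t ht
  rw [contDiff_one_iff_deriv]
  refine ⟨fun t => (key t).differentiableAt, ?_⟩
  have : deriv (fun t => t * (R - t) * f t) = fun t => (R - 2 * t) * f t + (R - t) * φ t :=
    funext fun t => (key t).deriv
  rw [this]
  fun_prop

lemma half_int (R Pinf : ℝ) (a : ℝ → ℝ) (hR : 0 < R) (hP : 0 < Pinf) (ha : ∀ t, Pinf ≤ a t)
    (H : ∀ f φ : ℝ → ℝ, Continuous f → Continuous φ → (∀ t, t ≠ 0 → HasDerivAt f (φ t / t) t) →
      IntegrableOn (fun t => a t * ((R - t) * φ t) ^ 2) (Ioo 0 R)) :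
    IntegrableOn a (Ioc 0 (R / 2)) := by
  have ha0 : ∀ t, 0 < a t := fun t => hP.trans_le (ha t)
  have hid := H (fun t => t) (fun t => t) continuous_id continuous_id (by
    intro t ht
    rw [div_self ht]
    exact hasDerivAt_id t)
  have hmeas : AEStronglyMeasurable a (volume.restrict (Ioo 0 R)) := by
    have h1 : AEStronglyMeasurable (fun t : ℝ => (((R - t) * t) ^ 2)⁻¹) (volume.restrict (Ioo 0 R)) :=
      (by fun_prop : Measurable (fun t : ℝ => (((R - t) * t) ^ 2)⁻¹)).aestronglyMeasurable
    refine (hid.aestronglyMeasurable.mul h1).congr ?_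
    filter_upwards [ae_restrict_mem measurableSet_Ioo] with t ht
    have : (R - t) * t ≠ 0 := mul_ne_zero (by linarith [ht.2]) (by linarith [ht.1])
    simp only [Pi.mul_apply]
    rw [mul_assoc, mul_inv_cancel₀ (pow_ne_zero 2 this), mul_one]
  set c := R / 2 with hc
  have hcR : c < R := by rw [hc]; linarith
  have hc0 : 0 < c := by rw [hc]; linarith
  have hRc : R = 2 * c := by rw [hc]; ring
  have hsub : Ioc 0 c ⊆ Ioo 0 R := fun t ht => ⟨ht.1, ht.2.trans_lt hcR⟩
  have hmeas' : AEStronglyMeasurable a (volume.restrict (Ioc 0 c)) :=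
    hmeas.mono_measure (Measure.restrict_mono hsub le_rfl)
  have hloc : ∀ r, 0 < r → IntegrableOn a (Ioc r c) := by
    intro r hr
    have hsr : Ioc r c ⊆ Ioc 0 c := fun t ht => ⟨hr.trans ht.1, ht.2⟩
    have h1 : IntegrableOn (fun t => ((c * r) ^ 2)⁻¹ * (a t * ((R - t) * t) ^ 2)) (Ioc r c) :=
      (hid.mono_set (hsr.trans hsub)).const_mul _
    refine Integrable.mono' h1 (hmeas'.mono_measure (Measure.restrict_mono hsr le_rfl)) ?_
    filter_upwards [ae_restrict_mem measurableSet_Ioc] with t ht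
    rw [Real.norm_eq_abs, abs_of_pos (ha0 t)]
    have hle : (c * r) ^ 2 ≤ ((R - t) * t) ^ 2 := by
      have h2 : c ≤ R - t := by linarith [ht.2]
      have h3 : r ≤ t := ht.1.le
      gcongr
      linarith
    have hpos : 0 < (c * r) ^ 2 := by positivity
    rw [le_inv_mul_iff₀ hpos, mul_comm]
    exact mul_le_mul_of_nonneg_left hle (ha0 t).le
  set A : ℝ → ℝ := fun r => ∫ s in Ioc r c, a s with hA
  have hA0 : ∀ r, 0 ≤ A r := fun r => integral_nonneg fun s => (ha0 s).le
  have hanti : ∀ r s, 0 < r → r ≤ s → A s ≤ A r := by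
    intro r s hr hrs
    exact setIntegral_mono_set (hloc r hr) (Filter.Eventually.of_forall fun s => (ha0 s).le)
      (Filter.Eventually.of_forall (Ioc_subset_Ioc_left hrs))
  have hAc : ∀ t, 0 < t → ContinuousAt A t := by
    intro t ht
    have e : ∀ x ∈ uIcc (t / 2) (t + c), (∫ s in x..(t + c), (Ioc 0 c).indicator a s) = A x := by
      intro x hx
      rw [uIcc_of_le (by linarith)] at hx
      rw [intervalIntegral.integral_of_le hx.2, setIntegral_indicator measurableSet_Ioc]
      have : Ioc x (t + c) ∩ Ioc 0 c = Ioc x c := by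
        ext y
        simp only [mem_inter_iff, mem_Ioc]
        constructor
        · rintro ⟨h1, h2⟩; exact ⟨h1.1, h2.2⟩
        · rintro ⟨h1, h2⟩; exact ⟨⟨h1, by linarith⟩, by linarith [hx.1], h2⟩
      rw [this]
    have hi : IntegrableOn ((Ioc 0 c).indicator a) (uIcc (t / 2) (t + c)) := by
      rw [uIcc_of_le (by linarith)]
      rw [IntegrableOn, integrable_indicator_iff measurableSet_Ioc, IntegrableOn,
        Measure.restrict_restrict measurableSet_Ioc]
      refine (hloc (t / 4) (by linarith)).mono_set ?_
      intro y hy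
      exact ⟨by linarith [hy.2.1], hy.1.2⟩
    have h1 := intervalIntegral.continuousOn_primitive_interval_left hi
    have h2 := h1.congr (fun x hx => (e x hx).symm)
    refine h2.continuousAt ?_
    rw [uIcc_of_le (by linarith)]
    exact Icc_mem_nhds (by linarith) (by linarith)
  by_contra hcon
  have hunb : ∀ N : ℝ, ∃ r, 0 < r ∧ N < A r := by
    intro N
    by_contra hN
    push Not at hN
    apply hcon
    refine integrableOn_Ioc_of_intervalIntegral_norm_bounded_left (l := Filter.atTop)
      (a := fun n : ℕ => 1 / ((n : ℝ) + 1)) (I := N) (fun n => hloc _ (by positivity))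
      tendsto_one_div_add_atTop_nhds_zero_nat (Filter.Eventually.of_forall fun n => ?_)
    have : ∀ x, ‖a x‖ = a x := fun x => by rw [Real.norm_eq_abs, abs_of_pos (ha0 x)]
    simp only [this]
    exact hN _ (by positivity)
  set k : ℝ → ℝ := fun t => if t ≤ 0 then 0 else 1 / √(√(1 + A t)) with hk
  have hs0 : ∀ t, 0 < √(√(1 + A t)) := fun t => by
    have := hA0 t
    positivity
  have hkpos : ∀ t, 0 < t → k t = 1 / √(√(1 + A t)) := fun t ht => by
    simp only [hk, if_neg (not_le.mpr ht)]
  have hk0 : ∀ t ≤ 0, k t = 0 := fun t ht => by simp only [hk, if_pos ht]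
  have hkn : ∀ t, 0 ≤ k t := by
    intro t
    rcases le_or_gt t 0 with h | h
    · rw [hk0 t h]
    · rw [hkpos t h]; positivity
  have hmono : Monotone k := by
    intro s t hst
    rcases le_or_gt s 0 with h | h
    · rw [hk0 s h]; exact hkn t
    · rw [hkpos s h, hkpos t (h.trans_le hst)]
      apply one_div_le_one_div_of_le (hs0 t)
      have := hanti s t h hst
      gcongr
  have hkc : Continuous k := by
    rw [continuous_iff_continuousAt]
    intro t
    rcases lt_trichotomy t 0 with h | h | h
    · have : k =ᶠ[nhds t] fun _ => 0 := by
        filter_upwards [Iio_mem_nhds h] with x hx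
        exact hk0 x (le_of_lt hx)
      exact continuousAt_const.congr this.symm
    · subst h
      rw [Metric.continuousAt_iff]
      intro ε hε
      obtain ⟨r, hr, hNr⟩ := hunb ((1 / ε) ^ 4)
      refine ⟨r, hr, fun {x} hx => ?_⟩
      rw [hk0 0 le_rfl, Real.dist_eq, sub_zero, abs_of_nonneg (hkn x)]
      rw [Real.dist_eq, sub_zero] at hx
      refine (hmono ((le_abs_self x).trans hx.le)).trans_lt ?_
      rw [hkpos r hr]
      rw [one_div_lt (hs0 r) hε]
      apply Real.lt_sqrt_of_sq_lt
      apply Real.lt_sqrt_of_sq_lt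
      calc ((1 / ε) ^ 2) ^ 2 = (1 / ε) ^ 4 := by ring
        _ < 1 + A r := by linarith
    · have : k =ᶠ[nhds t] fun t => 1 / √(√(1 + A t)) := by
        filter_upwards [Ioi_mem_nhds h] with x hx
        exact hkpos x hx
      refine ContinuousAt.congr ?_ this.symm
      have h1 := hAc t h
      exact continuousAt_const.div (continuousAt_const.add h1).sqrt.sqrt (hs0 t).ne'
  obtain ⟨f₁, φ₁, f₂, φ₂, ⟨a1, a2, a3⟩, ⟨b1, b2, b3⟩, hkk⟩ := osc k hkc hmono hk0
  have hkint : IntegrableOn (fun t => a t * k t ^ 2) (Ioc 0 c) := by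
    have h1 : IntegrableOn (fun t => (c ^ 2)⁻¹ * (a t * ((R - t) * φ₁ t) ^ 2 + a t * ((R - t) * φ₂ t) ^ 2)) (Ioc 0 c) :=
      (((H f₁ φ₁ a1 a2 a3).add (H f₂ φ₂ b1 b2 b3)).mono_set hsub).const_mul _
    refine Integrable.mono' h1 (hmeas'.mul (hkc.pow 2).aestronglyMeasurable) ?_
    filter_upwards [ae_restrict_mem measurableSet_Ioc] with t ht
    rw [Real.norm_eq_abs, abs_of_nonneg (mul_nonneg (ha0 t).le (sq_nonneg _))]
    rw [le_inv_mul_iff₀ (by positivity)]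
    have h2 : c ^ 2 ≤ (R - t) ^ 2 := by
      have : c ≤ R - t := by linarith [ht.2]
      gcongr
    have h3 : c ^ 2 * k t ^ 2 ≤ (R - t) ^ 2 * (φ₁ t ^ 2 + φ₂ t ^ 2) :=
      mul_le_mul h2 (hkk t) (sq_nonneg _) (sq_nonneg _)
    have h4 := mul_le_mul_of_nonneg_left h3 (ha0 t).le
    nlinarith
  set I := ∫ t in Ioc 0 c, a t * k t ^ 2 with hI
  have hI0 : 0 ≤ I := integral_nonneg fun t => mul_nonneg (ha0 t).le (sq_nonneg _)
  have hbd : ∀ r, 0 < r → A r / √(1 + A r) ≤ I := by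
    intro r hr
    have hsr : Ioc r c ⊆ Ioc 0 c := fun t ht => ⟨hr.trans ht.1, ht.2⟩
    have e1 : A r / √(1 + A r) = ∫ t in Ioc r c, a t * k r ^ 2 := by
      rw [integral_mul_const, hkpos r hr, div_pow, Real.sq_sqrt (by positivity)]
      simp only [hA]
      ring
    rw [e1]
    calc (∫ t in Ioc r c, a t * k r ^ 2) ≤ ∫ t in Ioc r c, a t * k t ^ 2 := by
          refine setIntegral_mono_on ((hloc r hr).mul_const _) (hkint.mono_set hsr) measurableSet_Ioc ?_
          intro t ht
          have h1 := hmono ht.1.le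
          have h2 := hkn r
          have h3 := (ha0 t).le
          gcongr
      _ ≤ I := setIntegral_mono_set hkint
          (Filter.Eventually.of_forall fun t => mul_nonneg (ha0 t).le (sq_nonneg _))
          (Filter.Eventually.of_forall hsr)
  obtain ⟨r, hr, hN⟩ := hunb (I ^ 2 + 1)
  have h1 := hbd r hr
  have h2 := hA0 r
  rw [div_le_iff₀ (by positivity)] at h1
  have h3 : (A r) ^ 2 ≤ I ^ 2 * (1 + A r) := by
    calc (A r) ^ 2 ≤ (I * √(1 + A r)) ^ 2 := by gcongr
      _ = _ := by rw [mul_pow, Real.sq_sqrt (by positivity)]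
  nlinarith [sq_nonneg I]

/-- The one-dimensional quadratic form. -/
noncomputable def FF (G₁ G₂ a η : ℝ → ℝ) (t : ℝ) : ℝ :=
  G₁ t * η t ^ 2 + 2 * G₂ t * deriv η t * η t - a t * deriv η t ^ 2

lemma polar (l u : ℝ) (G₁ G₂ a : ℝ → ℝ)
    (HF : ∀ η : ℝ → ℝ, ContDiff ℝ 1 η → η l = 0 → η u = 0 → IntegrableOn (FF G₁ G₂ a η) (Ioo l u))
    (η f f' : ℝ → ℝ) (h1 : ContDiff ℝ 1 η) (h2 : ContDiff ℝ 1 (fun t => η t * f t))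
    (h3 : ContDiff ℝ 1 (fun t => η t * f t ^ 2)) (hl : η l = 0) (hu : η u = 0)
    (hf : ∀ t ∈ Ioo l u, HasDerivAt f (f' t) t) :
    IntegrableOn (fun t => a t * (η t * f' t) ^ 2) (Ioo l u) := by
  have i1 := HF _ h1 hl hu
  have i2 := HF _ h2 (by simp [hl]) (by simp [hu])
  have i3 := HF _ h3 (by simp [hl]) (by simp [hu])
  have i4 := HF _ (h1.add h3) (by simp [hl]) (by simp [hu])
  have i5 := (((i4.sub i1).sub i3).sub (i2.const_mul 2)).const_mul (1 / 2)
  refine IntegrableOn.congr_fun i5 ?_ measurableSet_Ioo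
  intro t ht
  have d1 : HasDerivAt η (deriv η t) t := (h1.differentiable one_ne_zero t).hasDerivAt
  have d2 := d1.mul (hf t ht)
  have d3 := d1.mul ((hf t ht).pow 2)
  have d4 := d1.add d3
  have e2 : deriv (fun t => η t * f t) t = deriv η t * f t + η t * f' t := d2.deriv
  have e3 : deriv (fun t => η t * f t ^ 2) t = deriv η t * f t ^ 2 + η t * (2 * f t * f' t) := by
    rw [show deriv (fun t => η t * f t ^ 2) t = _ from d3.deriv]
    simp
  have e4 : deriv (fun t => η t + η t * f t ^ 2) t
      = deriv η t + (deriv η t * f t ^ 2 + η t * (2 * f t * f' t)) := by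
    rw [show deriv (fun t => η t + η t * f t ^ 2) t = _ from d4.deriv]
    simp
  simp only [Pi.sub_apply, FF, e2, e3, e4, Pi.add_apply]
  ring

lemma full_int (l u Pinf : ℝ) (hlu : l < u) (hP : 0 < Pinf) (G₁ G₂ a : ℝ → ℝ) (ha : ∀ t, Pinf ≤ a t)
    (HF : ∀ η : ℝ → ℝ, ContDiff ℝ 1 η → η l = 0 → η u = 0 → IntegrableOn (FF G₁ G₂ a η) (Ioo l u)) :
    IntegrableOn a (Ioo l u) := by
  have hone : ContDiff ℝ 1 (fun t : ℝ => t * ((u - l) - t)) := by fun_prop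
  -- general reflected or translated version
  have gen : ∀ S S' : ℝ → ℝ, ∀ σ : ℝ, σ ^ 2 = 1 → (∀ t, HasDerivAt S σ t) → ContDiff ℝ 1 S →
      MeasurePreserving S' volume volume → MeasurableEmbedding S' → (∀ t, S (S' t) = t) →
      S' ⁻¹' (Ioo l u) = Ioo 0 (u - l) →
      (∀ t ∈ Ioo l u, 0 < S t) → (S l * (u - l - S l) = 0) → (S u * (u - l - S u) = 0) →
      IntegrableOn (fun t => a (S' t)) (Ioc 0 ((u - l) / 2)) := by
    intro S S' σ hσ hS hSc hS' hS'e hinv hpre hpos hSl hSu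
    refine half_int (u - l) Pinf (fun t => a (S' t)) (by linarith) hP (fun t => ha _) ?_
    intro f φ hf hφ hd
    have c1 := contDiff_ff (u - l) f φ hf hφ hd
    have c2 := contDiff_ff (u - l) (fun t => f t ^ 2) (fun t => 2 * f t * φ t) (by fun_prop) (by fun_prop) (by
      intro t ht
      refine ((hd t ht).pow 2).congr_deriv ?_
      simp
      field_simp)
    have := polar l u G₁ G₂ a HF (fun t => S t * (u - l - S t)) (fun t => f (S t))
      (fun t => φ (S t) / S t * σ) (hone.comp hSc) (c1.comp hSc) (c2.comp hSc) hSl hSu (by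
        intro t ht
        exact (hd (S t) (hpos t ht).ne').comp t (hS t))
    rw [← hS'.integrableOn_comp_preimage hS'e, hpre] at this
    refine this.congr_fun ?_ measurableSet_Ioo
    intro t ht
    simp only [Function.comp, hinv]
    have ht0 : t ≠ 0 := ht.1.ne'
    have : (t * (u - l - t) * (φ t / t * σ)) ^ 2 = ((u - l - t) * φ t) ^ 2 * σ ^ 2 := by
      field_simp
    rw [this, hσ, mul_one]
  have L := gen (fun t => t - l) (fun t => t + l) 1 (by norm_num)
    (fun t => (hasDerivAt_id t).sub_const l) (by fun_prop) (measurePreserving_add_right volume l)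
    (measurableEmbedding_addRight l) (fun t => by ring) (by ext t; simp [lt_sub_iff_add_lt])
    (fun t ht => by linarith [ht.1]) (by ring) (by ring)
  have Rr := gen (fun t => u - t) (fun t => u - t) (-1) (by norm_num)
    (fun t => by simpa using (hasDerivAt_id t).const_sub u) (by fun_prop) (Measure.measurePreserving_sub_left volume u)
    (MeasurableEquiv.subLeft u).measurableEmbedding (fun t => by ring)
    (by
      ext t
      simp only [mem_preimage, mem_Ioo]
      constructor <;> rintro ⟨h1, h2⟩ <;> constructor <;> linarith)
    (fun t ht => by linarith [ht.2]) (by ring) (by ring)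
  have L' : IntegrableOn a (Ioc l ((l + u) / 2)) := by
    rw [← (measurePreserving_add_right volume l).integrableOn_comp_preimage (measurableEmbedding_addRight l)]
    have e : (fun x => x + l) ⁻¹' Ioc l ((l + u) / 2) = Ioc 0 ((u - l) / 2) := by
      ext t
      simp only [mem_preimage, mem_Ioc]
      constructor <;> rintro ⟨h1, h2⟩ <;> constructor <;> linarith
    rw [e]
    exact L
  have R' : IntegrableOn a (Ico ((l + u) / 2) u) := by
    rw [← (Measure.measurePreserving_sub_left volume u).integrableOn_comp_preimage (MeasurableEquiv.subLeft u).measurableEmbedding]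
    have e : (fun x => u - x) ⁻¹' Ico ((l + u) / 2) u = Ioc 0 ((u - l) / 2) := by
      ext t
      simp only [mem_preimage, mem_Ioc, mem_Ico]
      constructor <;> rintro ⟨h1, h2⟩ <;> constructor <;> linarith
    rw [e]
    exact Rr
  refine (L'.union R').mono_set ?_
  intro t ht
  rcases le_total t ((l + u) / 2) with h | h
  · exact Or.inl ⟨ht.1, h⟩
  · exact Or.inr ⟨h, ht.2⟩

lemma slab_eq_pi (hm hp L₁ L₂ : ℝ) : slab hm hp L₁ L₂ =
    univ.pi fun i => Ioo ((![0, 0, hm] : Fin 3 → ℝ) i) ((![2 * π * L₁, 2 * π * L₂, hp] : Fin 3 → ℝ) i) := by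
  ext x
  simp [slab, Fin.forall_fin_succ]

lemma slab_ae_eq (hm hp L₁ L₂ : ℝ) : slab hm hp L₁ L₂ =ᵐ[volume]
    Icc (![0, 0, hm] : Fin 3 → ℝ) (![2 * π * L₁, 2 * π * L₂, hp] : Fin 3 → ℝ) := by
  rw [slab_eq_pi]
  exact Measure.univ_pi_Ioo_ae_eq_Icc

lemma slab_subset (hm hp L₁ L₂ : ℝ) : slab hm hp L₁ L₂ ⊆
    Icc (![0, 0, hm] : Fin 3 → ℝ) (![2 * π * L₁, 2 * π * L₂, hp] : Fin 3 → ℝ) := by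
  rw [slab_eq_pi]
  intro x hx
  exact ⟨fun i => (hx i (mem_univ i)).1.le, fun i => (hx i (mem_univ i)).2.le⟩

lemma slab_meas (hm hp L₁ L₂ : ℝ) : MeasurableSet (slab hm hp L₁ L₂) := by
  rw [slab_eq_pi]
  exact MeasurableSet.univ_pi fun i => measurableSet_Ioo

lemma slab_int (hm hp L₁ L₂ : ℝ) (f : (Fin 3 → ℝ) → ℝ) (hf : Continuous f) :
    IntegrableOn f (slab hm hp L₁ L₂) :=
  (hf.continuousOn.integrableOn_compact isCompact_Icc).mono_set (slab_subset hm hp L₁ L₂)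

lemma slab_fubini (hm hp L₁ L₂ : ℝ) (hL₁ : 0 < L₁) (hL₂ : 0 < L₂) (F : ℝ → ℝ) :
    IntegrableOn (fun x => F (x 2)) (slab hm hp L₁ L₂) ↔ IntegrableOn F (Ioo hm hp) := by
  set B : Set (Fin 2 → ℝ) := univ.pi fun i => Ioo 0 ((![2 * π * L₁, 2 * π * L₂] : Fin 2 → ℝ) i) with hB
  have hpre : (MeasurableEquiv.piFinSuccAbove (fun _ : Fin 3 => ℝ) 2) ⁻¹' (Ioo hm hp ×ˢ B) = slab hm hp L₁ L₂ := by
    ext x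
    simp [slab, hB, MeasurableEquiv.piFinSuccAbove, Fin.forall_fin_succ, Fin.succAbove]
    tauto
  have hBo : IsOpen B := isOpen_set_pi finite_univ fun i _ => isOpen_Ioo
  have hBn : B.Nonempty := by
    rw [hB, univ_pi_nonempty_iff]
    intro i
    rw [nonempty_Ioo]
    fin_cases i <;> simp <;> positivity
  have hBf : volume B < ⊤ := by
    have : B ⊆ Icc 0 (![2 * π * L₁, 2 * π * L₂] : Fin 2 → ℝ) := by
      intro x hx
      exact ⟨fun i => (hx i (mem_univ i)).1.le, fun i => (hx i (mem_univ i)).2.le⟩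
    exact (measure_mono this).trans_lt isCompact_Icc.measure_lt_top
  have hBp : volume B ≠ 0 := (hBo.measure_pos volume hBn).ne'
  have hmp := volume_preserving_piFinSuccAbove (fun _ : Fin 3 => ℝ) 2
  have h1 := hmp.integrableOn_comp_preimage (f := fun p : ℝ × (Fin 2 → ℝ) => F p.1) (s := Ioo hm hp ×ˢ B)
    (MeasurableEquiv.measurableEmbedding _)
  rw [hpre] at h1
  have h2 : ((fun p : ℝ × (Fin 2 → ℝ) => F p.1) ∘ (MeasurableEquiv.piFinSuccAbove (fun _ : Fin 3 => ℝ) 2))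
    = fun x : Fin 3 → ℝ => F (x 2) := by
    rfl
  rw [h2] at h1
  refine h1.trans ?_
  have : IsFiniteMeasure (volume.restrict B) := ⟨by simpa using hBf⟩
  have : NeZero (volume.restrict B) := ⟨by rwa [Ne, Measure.restrict_eq_zero]⟩
  rw [IntegrableOn, Measure.volume_eq_prod, ← Measure.prod_restrict]
  constructor
  · intro h
    obtain ⟨y, hy⟩ := h.prod_left_ae.exists
    exact hy
  · intro h
    exact Integrable.comp_fst h _

lemma insertNth_eq (i : Fin 3) (s : ℝ) (x : Fin 2 → ℝ) :
    (i.insertNth s x : Fin 3 → ℝ) = (i.insertNth 0 x : Fin 3 → ℝ) + s • (Pi.single i 1 : Fin 3 → ℝ) := by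
  ext j
  rcases Fin.eq_self_or_eq_succAbove i j with h | ⟨k, h⟩
  · subst h; simp
  · subst h; simp

lemma continuous_pd (k : Fin 3) (v : (Fin 3 → ℝ) → ℝ) (hv : ContDiff ℝ 1 v) : Continuous (pd k v) :=
  (hv.continuous_fderiv one_ne_zero).clm_apply continuous_const

lemma poincare (hm hp L₁ L₂ : ℝ) (hlu : hm < hp) (hL₁ : 0 < L₁) (hL₂ : 0 < L₂) (M : Fin 3 → ℝ)
    (v : (Fin 3 → ℝ) → ℝ) (hv : ContDiff ℝ 1 v) (hz : ∀ x : Fin 3 → ℝ, x 2 = hm ∨ x 2 = hp → v x = 0)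
    (hp1 : ∀ x, v (x + (2 * π * L₁) • (Pi.single 0 1 : Fin 3 → ℝ)) = v x)
    (hp2 : ∀ x, v (x + (2 * π * L₂) • (Pi.single 1 1 : Fin 3 → ℝ)) = v x) :
    (M 2) ^ 2 * (∫ x in slab hm hp L₁ L₂, (v x) ^ 2) ≤
      4 * (hp - hm) ^ 2 * ∫ x in slab hm hp L₁ L₂, (∑ k, M k * pd k v x) ^ 2 := by
  set A : Fin 3 → ℝ := ![0, 0, hm] with hA
  set Bb : Fin 3 → ℝ := ![2 * π * L₁, 2 * π * L₂, hp] with hBb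
  set m : (Fin 3 → ℝ) → ℝ := fun x => ∑ k, M k * pd k v x with hmdef
  have hvc : Continuous v := hv.continuous
  have hmc : Continuous m := continuous_finsetSum _ fun k _ => continuous_const.mul (continuous_pd k v hv)
  set G : (Fin 3 → ℝ) → ℝ := fun x => v x ^ 2 * (x 2 - hm) with hG
  set G' : (Fin 3 → ℝ) → ((Fin 3 → ℝ) →L[ℝ] ℝ) := fun x =>
    (2 * v x * (x 2 - hm)) • fderiv ℝ v x + (v x ^ 2) • ContinuousLinearMap.proj (R := ℝ) (φ := fun _ : Fin 3 => ℝ) 2 with hG'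
  have hGd : ∀ x, HasFDerivAt G (G' x) x := by
    intro x
    have d1 : HasFDerivAt v (fderiv ℝ v x) x := (hv.differentiable one_ne_zero x).hasFDerivAt
    have d2 : HasFDerivAt (fun x : Fin 3 → ℝ => x 2 - hm)
      (ContinuousLinearMap.proj (R := ℝ) (φ := fun _ : Fin 3 => ℝ) 2) x :=
      (hasFDerivAt_apply 2 x).sub_const hm
    refine ((d1.pow 2).mul d2).congr_fderiv ?_
    ext y
    simp [hG']
    ring
  have hdiv : ∀ x, (∑ i, (ContinuousLinearMap.pi (fun i => M i • G' x)) (Pi.single i 1) i)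
      = 2 * v x * (x 2 - hm) * m x + M 2 * v x ^ 2 := by
    intro x
    simp [hG', hmdef, Fin.sum_univ_three, pd]
    ring
  have hAB : A ≤ Bb := by
    intro i
    fin_cases i <;> simp [hA, hBb] <;> first | positivity | exact hlu.le
  have hcont : Continuous fun x : Fin 3 → ℝ => 2 * v x * (x 2 - hm) * m x + M 2 * v x ^ 2 := by fun_prop
  have key := integral_divergence_of_hasFDerivAt_off_countable A Bb hAB (fun x i => M i * G x)
    (fun x => ContinuousLinearMap.pi (fun i => M i • G' x)) ∅ countable_empty
    (by
      have : Continuous G := by rw [hG]; fun_prop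
      exact (by fun_prop : Continuous fun x i => M i * G x).continuousOn)
    (by
      intro x _
      rw [hasFDerivAt_pi]
      intro i
      exact (hGd x).const_mul (M i))
    (by
      simp only [hdiv]
      exact hcont.continuousOn.integrableOn_compact isCompact_Icc)
  have hface : ∀ i : Fin 3, ∀ x : Fin 2 → ℝ, G (i.insertNth (Bb i) x) = G (i.insertNth (A i) x) := by
    intro i x
    fin_cases i
    · change G ((0 : Fin 3).insertNth (2 * π * L₁) x) = G ((0 : Fin 3).insertNth 0 x)
      rw [insertNth_eq 0 (2 * π * L₁) x]
      simp only [hG, hp1]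
      simp
    · change G ((1 : Fin 3).insertNth (2 * π * L₂) x) = G ((1 : Fin 3).insertNth 0 x)
      rw [insertNth_eq 1 (2 * π * L₂) x]
      simp only [hG, hp2]
      simp
    · change G ((2 : Fin 3).insertNth hp x) = G ((2 : Fin 3).insertNth hm x)
      simp only [hG]
      rw [hz ((2 : Fin 3).insertNth hp x) (Or.inr (by simp)), hz ((2 : Fin 3).insertNth hm x) (Or.inl (by simp))]
      simp
  simp only [hdiv, hface, sub_self, Finset.sum_const_zero] at key
  rw [← setIntegral_congr_set (slab_ae_eq hm hp L₁ L₂)] at key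
  have i1 := slab_int hm hp L₁ L₂ _ hcont
  have i2 := slab_int hm hp L₁ L₂ (fun x => v x ^ 2) (by fun_prop)
  have i3 := slab_int hm hp L₁ L₂ (fun x => m x ^ 2) (by fun_prop)
  have hle : (∫ x in slab hm hp L₁ L₂, M 2 ^ 2 / 2 * v x ^ 2) ≤
      ∫ x in slab hm hp L₁ L₂, (M 2 * (2 * v x * (x 2 - hm) * m x + M 2 * v x ^ 2) + 2 * (hp - hm) ^ 2 * m x ^ 2) := by
    refine setIntegral_mono_on (i2.const_mul _) ((i1.const_mul _).add (i3.const_mul _)) (slab_meas _ _ _ _) ?_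
    intro x hx
    have h1 : 0 ≤ x 2 - hm := by linarith [hx.2.2.1]
    have h2 : x 2 - hm ≤ hp - hm := by linarith [hx.2.2.2]
    have h3 : (x 2 - hm) ^ 2 * m x ^ 2 ≤ (hp - hm) ^ 2 * m x ^ 2 := by gcongr
    nlinarith [sq_nonneg (M 2 * v x + 2 * (x 2 - hm) * m x)]
  rw [integral_add (i1.const_mul _) (i3.const_mul _), integral_const_mul, integral_const_mul, integral_const_mul,
    key] at hle
  linarith

lemma pd_test (φ : ℝ → ℝ) (hφ : ContDiff ℝ 1 φ) (c : ℝ) (k : Fin 3) (x : Fin 3 → ℝ) :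
    pd k (fun y => φ (y 2) * c) x = deriv φ (x 2) * c * (Pi.single k 1 : Fin 3 → ℝ) 2 := by
  have d1 : HasDerivAt φ (deriv φ (x 2)) (x 2) := (hφ.differentiable one_ne_zero _).hasDerivAt
  have d2 : HasFDerivAt (fun y : Fin 3 → ℝ => y 2)
      (ContinuousLinearMap.proj (R := ℝ) (φ := fun _ : Fin 3 => ℝ) 2) x := hasFDerivAt_apply 2 x
  have d3 := (d1.comp_hasFDerivAt x d2).mul_const c
  unfold pd
  rw [show fderiv ℝ (fun y : Fin 3 → ℝ => φ (y 2) * c) x = _ from d3.fderiv]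
  simp
  ring

lemma divg_test (φ : ℝ → ℝ) (hφ : ContDiff ℝ 1 φ) (M : Fin 3 → ℝ) (x : Fin 3 → ℝ) :
    divg (fun y i => φ (y 2) * M i) x = deriv φ (x 2) * M 2 := by
  simp [divg, pd_test φ hφ, Fin.sum_univ_three]

lemma mdir_test (φ : ℝ → ℝ) (hφ : ContDiff ℝ 1 φ) (M : Fin 3 → ℝ) (i : Fin 3) (x : Fin 3 → ℝ) :
    mdir M (fun y i => φ (y 2) * M i) i x = deriv φ (x 2) * M 2 * M i := by
  simp [mdir, pd_test φ hφ, Fin.sum_univ_three]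
  ring

lemma mem_test (hm hp L₁ L₂ : ℝ) (φ : ℝ → ℝ) (hφ : ContDiff ℝ 1 φ) (h1 : φ hm = 0) (h2 : φ hp = 0)
    (M : Fin 3 → ℝ) : memH10 hm hp L₁ L₂ (fun y i => φ (y 2) * M i) := by
  refine ⟨?_, ?_, ?_, ?_⟩
  · rw [contDiff_pi]
    intro i
    exact (hφ.comp (contDiff_apply ℝ ℝ 2)).mul contDiff_const
  · intro x hx
    ext i
    rcases hx with h | h <;> simp [h, h1, h2]
  · intro x
    ext i
    simp
  · intro x
    ext i
    simp

/-- Stabilizing estimate under the stability condition `Ξ < 1` with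
`M̄₃ ≠ 0`: `‖w‖²₀ + ‖M̄·∇w‖²₀ + ‖div w‖²₀ ≲ -E(w)` for all `w ∈ H¹₀(Ω)³`, where
`E(w) = g⟦ρ̄⟧∫_Σ w₃² + ∫_Ω (gρ̄'w₃² + 2gρ̄ div w w₃ - P'(ρ̄)ρ̄ |div w|²) - λ‖div w M̄ - M̄·∇w‖²₀`
and the hypothesis `Ξ < 1` is expressed by `E(w) + D(w) ≤ Ξ D(w)` for all `w ∈ H¹₀`. -/
theorem stabilizing_estimate
    (hm hp L₁ L₂ g lam Pinf jmp Ξ : ℝ)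
    (hhm : hm < 0) (hhp : 0 < hp) (hL₁ : 0 < L₁) (hL₂ : 0 < L₂)
    (hg : 0 < g) (hlam : 0 < lam) (hPinf : 0 < Pinf) (hjmp : 0 < jmp)
    (ρ ρ' a : ℝ → ℝ) (ha : ∀ t, Pinf ≤ a t)
    (M : Fin 3 → ℝ) (hM3 : M 2 ≠ 0)
    (E D : ((Fin 3 → ℝ) → (Fin 3 → ℝ)) → ℝ)
    (hE : ∀ w, E w =
      g * jmp * (∫ p in (Ioo 0 (2 * π * L₁)) ×ˢ (Ioo 0 (2 * π * L₂)),
          (w ![p.1, p.2, (0 : ℝ)] 2) ^ 2)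
      + (∫ x in slab hm hp L₁ L₂,
          (g * ρ' (x 2) * (w x 2) ^ 2 + 2 * g * ρ (x 2) * divg w x * w x 2
            - a (x 2) * (divg w x) ^ 2))
      - lam * ∫ x in slab hm hp L₁ L₂, ∑ i, (divg w x * M i - mdir M w i x) ^ 2)
    (hD : ∀ w, D w =
      (∫ x in slab hm hp L₁ L₂, a (x 2) * (divg w x) ^ 2)
      + lam * ∫ x in slab hm hp L₁ L₂, ∑ i, (divg w x * M i - mdir M w i x) ^ 2)
    (hΞ : Ξ < 1)
    (hsup : ∀ w, memH10 hm hp L₁ L₂ w → E w + D w ≤ Ξ * D w) :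
    ∃ C > 0, ∀ w, memH10 hm hp L₁ L₂ w →
      (∫ x in slab hm hp L₁ L₂, ∑ i, (w x i) ^ 2)
        + (∫ x in slab hm hp L₁ L₂, ∑ i, (mdir M w i x) ^ 2)
        + (∫ x in slab hm hp L₁ L₂, (divg w x) ^ 2) ≤ C * (-(E w)) := by
  have hD0 : ∀ w, 0 ≤ D w := by
    intro w
    rw [hD]
    have h1 : 0 ≤ ∫ x in slab hm hp L₁ L₂, a (x 2) * (divg w x) ^ 2 :=
      integral_nonneg fun x => mul_nonneg (hPinf.le.trans (ha _)) (sq_nonneg _)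
    have h2 : 0 ≤ ∫ x in slab hm hp L₁ L₂, ∑ i, (divg w x * M i - mdir M w i x) ^ 2 :=
      integral_nonneg fun x => Finset.sum_nonneg fun i _ => sq_nonneg _
    positivity
  have hE0 : ∀ w, memH10 hm hp L₁ L₂ w → (1 - Ξ) * D w ≤ - E w := by
    intro w hw
    linarith [hsup w hw]
  have hlu : hm < hp := hhm.trans hhp
  have hπ : 0 < π := Real.pi_pos
  -- the one-dimensional form is integrable for nonvanishing test functions
  have step1 : ∀ φ : ℝ → ℝ, ContDiff ℝ 1 φ → φ hm = 0 → φ hp = 0 → φ 0 ≠ 0 →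
      IntegrableOn (FF (fun t => g * ρ' t) (fun t => g * ρ t) a φ) (Ioo hm hp) := by
    intro φ hφ h1 h2 h0
    by_contra hcon
    have hw := mem_test hm hp L₁ L₂ φ hφ h1 h2 M
    have h3 := hE0 _ hw
    have h4 := hD0 (fun y i => φ (y 2) * M i)
    have h5 : E (fun y i => φ (y 2) * M i) ≤ 0 := by
      have : 0 ≤ (1 - Ξ) * D (fun y i => φ (y 2) * M i) := mul_nonneg (by linarith) h4
      linarith
    rw [hE] at h5
    have e1 : ∀ x : Fin 3 → ℝ, (g * ρ' (x 2) * (φ (x 2) * M 2) ^ 2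
        + 2 * g * ρ (x 2) * (deriv φ (x 2) * M 2) * (φ (x 2) * M 2)
            - a (x 2) * (deriv φ (x 2) * M 2) ^ 2)
        = M 2 ^ 2 * FF (fun t => g * ρ' t) (fun t => g * ρ t) a φ (x 2) := by
      intro x
      unfold FF
      ring
    have e2 : ∫ x in slab hm hp L₁ L₂, FF (fun t => g * ρ' t) (fun t => g * ρ t) a φ (x 2) = 0 := by
      apply integral_undef
      intro hc
      exact hcon ((slab_fubini hm hp L₁ L₂ hL₁ hL₂ _).1 hc)
    simp only [divg_test φ hφ, mdir_test φ hφ, e1] at h5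
    rw [integral_const_mul, e2] at h5
    simp only [sub_self, mul_zero, add_zero] at h5
    have e3 : (![(0:ℝ), 0, 0] : Fin 3 → ℝ) 2 = 0 := rfl
    have e4 : ∀ p : ℝ × ℝ, (![p.1, p.2, (0:ℝ)] : Fin 3 → ℝ) 2 = 0 := fun p => rfl
    simp only [e4] at h5
    rw [setIntegral_const] at h5
    have hvol : 0 < volume.real ((Ioo 0 (2 * π * L₁)) ×ˢ (Ioo 0 (2 * π * L₂))) := by
      rw [Measure.volume_eq_prod, measureReal_prod_prod]
      simp only [Real.volume_real_Ioo_of_le (by positivity : (0:ℝ) ≤ 2 * π * L₁),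
        Real.volume_real_Ioo_of_le (by positivity : (0:ℝ) ≤ 2 * π * L₂)]
      simp only [sub_zero]
      positivity
    have : 0 < g * jmp * (volume.real ((Ioo 0 (2 * π * L₁)) ×ˢ (Ioo 0 (2 * π * L₂))) • (φ 0 * M 2) ^ 2) := by
      rw [smul_eq_mul]
      positivity
    simp at h5
    simp at this
    linarith
  have step2 : ∀ φ : ℝ → ℝ, ContDiff ℝ 1 φ → φ hm = 0 → φ hp = 0 →
      IntegrableOn (FF (fun t => g * ρ' t) (fun t => g * ρ t) a φ) (Ioo hm hp) := by
    intro φ hφ h1 h2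
    by_cases h0 : φ 0 = 0
    · set p : ℝ → ℝ := fun t => (t - hm) * (hp - t) with hpd
      have hpc : ContDiff ℝ 1 p := by rw [hpd]; fun_prop
      have hp0 : p 0 ≠ 0 := by
        simp only [hpd]
        have : 0 < (0 - hm) * (hp - 0) := mul_pos (by linarith) (by linarith)
        exact this.ne'
      have i1 := step1 p hpc (by simp [hpd]) (by simp [hpd]) hp0
      have i2 := step1 _ (hpc.add hφ) (by simp [hpd, h1]) (by simp [hpd, h2]) (by simpa [h0] using hp0)
      have i3 := step1 _ (hpc.sub hφ) (by simp [hpd, h1]) (by simp [hpd, h2]) (by simpa [h0] using hp0)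
      have i4 := ((i2.add i3).sub (i1.const_mul 2)).const_mul (1 / 2)
      refine IntegrableOn.congr_fun i4 ?_ measurableSet_Ioo
      intro t _
      have d1 : HasDerivAt φ (deriv φ t) t := (hφ.differentiable one_ne_zero t).hasDerivAt
      have d2 : HasDerivAt p (deriv p t) t := (hpc.differentiable one_ne_zero t).hasDerivAt
      have e1 : deriv (fun t => p t + φ t) t = deriv p t + deriv φ t := (d2.add d1).deriv
      have e2 : deriv (fun t => p t - φ t) t = deriv p t - deriv φ t := (d2.sub d1).deriv
      simp only [Pi.sub_apply, Pi.add_apply, FF, e1, e2]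
      ring
    · exact step1 φ hφ h1 h2 h0
  have haint : IntegrableOn a (Ioo hm hp) :=
    full_int hm hp Pinf hlu hPinf _ _ a ha step2
  have haslab : IntegrableOn (fun x => a (x 2)) (slab hm hp L₁ L₂) :=
    (slab_fubini hm hp L₁ L₂ hL₁ hL₂ a).2 haint
  have hM2 : 0 < M 2 ^ 2 := by positivity
  set K : ℝ := 4 * (hp - hm) ^ 2 / M 2 ^ 2 with hK
  have hK0 : 0 ≤ K := by positivity
  set N : ℝ := ∑ i, M i ^ 2 with hN
  have hN0 : 0 ≤ N := Finset.sum_nonneg fun i _ => sq_nonneg _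
  have hΞ' : 0 < 1 - Ξ := by linarith
  refine ⟨(((K + 1) * (2 * N) + 1) / Pinf + 2 * (K + 1) / lam) / (1 - Ξ), by positivity, ?_⟩
  intro w hw
  obtain ⟨hwc, hwz, hw1, hw2⟩ := id hw
  have hwi : ∀ i, ContDiff ℝ 1 (fun y => w y i) := fun i => contDiff_pi.1 hwc i
  have hwic : ∀ i, Continuous (fun y => w y i) := fun i => (hwi i).continuous
  have hdc : Continuous (divg w) := continuous_finsetSum _ fun i _ => continuous_pd i _ (hwi i)
  have hmc : ∀ i, Continuous (mdir M w i) := fun i =>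
    continuous_finsetSum _ fun k _ => continuous_const.mul (continuous_pd k _ (hwi i))
  set Sl := slab hm hp L₁ L₂ with hSl
  set S := ∫ x in Sl, (divg w x) ^ 2 with hS
  set U := ∫ x in Sl, ∑ i, (divg w x * M i - mdir M w i x) ^ 2 with hU
  set Q := ∫ x in Sl, ∑ i, (mdir M w i x) ^ 2 with hQ
  set W := ∫ x in Sl, ∑ i, (w x i) ^ 2 with hW
  have iS : IntegrableOn (fun x => (divg w x) ^ 2) Sl := slab_int _ _ _ _ _ (by fun_prop)
  have iU : IntegrableOn (fun x => ∑ i, (divg w x * M i - mdir M w i x) ^ 2) Sl :=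
    slab_int _ _ _ _ _ (continuous_finsetSum _ fun i _ => by have := hmc i; fun_prop)
  have iQ : IntegrableOn (fun x => ∑ i, (mdir M w i x) ^ 2) Sl :=
    slab_int _ _ _ _ _ (continuous_finsetSum _ fun i _ => by have := hmc i; fun_prop)
  have hS0 : 0 ≤ S := integral_nonneg fun x => sq_nonneg _
  have hU0 : 0 ≤ U := integral_nonneg fun x => Finset.sum_nonneg fun i _ => sq_nonneg _
  -- lower bound of the functional `D`
  have hDw : Pinf * S + lam * U ≤ D w := by
    rw [hD]
    have : Pinf * S ≤ ∫ x in Sl, a (x 2) * (divg w x) ^ 2 := by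
      rw [hS, ← integral_const_mul]
      refine setIntegral_mono_on (iS.const_mul _) ?_ (slab_meas _ _ _ _) ?_
      · obtain ⟨C, hC⟩ := (isCompact_Icc (a := (![0, 0, hm] : Fin 3 → ℝ))
          (b := ![2 * π * L₁, 2 * π * L₂, hp])).exists_bound_of_continuousOn (hdc.pow 2).continuousOn
        refine Integrable.mul_bdd (c := C) haslab (hdc.pow 2).aestronglyMeasurable ?_
        filter_upwards [ae_restrict_mem (slab_meas hm hp L₁ L₂)] with x hx
        exact hC x (slab_subset _ _ _ _ hx)
      · intro x _
        exact mul_le_mul_of_nonneg_right (ha _) (sq_nonneg _)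
    linarith
  have hQle : Q ≤ 2 * N * S + 2 * U := by
    rw [hQ, hS, hU, ← integral_const_mul, ← integral_const_mul,
      ← integral_add (iS.const_mul _) (iU.const_mul _)]
    refine setIntegral_mono_on iQ ((iS.const_mul _).add (iU.const_mul _)) (slab_meas _ _ _ _) ?_
    intro x _
    simp only [hN, Fin.sum_univ_three]
    nlinarith [sq_nonneg (2 * divg w x * M 0 - mdir M w 0 x), sq_nonneg (2 * divg w x * M 1 - mdir M w 1 x),
      sq_nonneg (2 * divg w x * M 2 - mdir M w 2 x)]
  have hWle : W ≤ K * Q := by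
    rw [hW, hQ, integral_finsetSum _ (fun i _ => slab_int _ _ _ _ _ (by have := hwic i; fun_prop)),
      integral_finsetSum _ (fun i _ => slab_int _ _ _ _ _ (by have := hmc i; fun_prop)), Finset.mul_sum]
    refine Finset.sum_le_sum fun i _ => ?_
    have := poincare hm hp L₁ L₂ hlu hL₁ hL₂ M (fun y => w y i) (hwi i)
      (fun x hx => by rw [hwz x hx]; rfl) (fun x => by rw [hw1 x]) (fun x => by rw [hw2 x])
    rw [hK, div_mul_eq_mul_div, le_div_iff₀ hM2, mul_comm]
    exact this
  have hfin := hE0 w hw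
  have h1 : W + Q + S ≤ ((K + 1) * (2 * N) + 1) * S + 2 * (K + 1) * U := by
    nlinarith [mul_le_mul_of_nonneg_left hQle hK0]
  have h2 : ((K + 1) * (2 * N) + 1) * S + 2 * (K + 1) * U ≤
      (((K + 1) * (2 * N) + 1) / Pinf + 2 * (K + 1) / lam) * (Pinf * S + lam * U) := by
    have e : (((K + 1) * (2 * N) + 1) / Pinf + 2 * (K + 1) / lam) * (Pinf * S + lam * U)
      = ((K + 1) * (2 * N) + 1) * S + 2 * (K + 1) * U
        + (((K + 1) * (2 * N) + 1) / Pinf * (lam * U) + 2 * (K + 1) / lam * (Pinf * S)) := by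
      field_simp
      ring
    rw [e]
    have : 0 ≤ (((K + 1) * (2 * N) + 1) / Pinf * (lam * U) + 2 * (K + 1) / lam * (Pinf * S)) := by positivity
    linarith
  have h3 : Pinf * S + lam * U ≤ (-(E w)) / (1 - Ξ) := by
    rw [le_div_iff₀ hΞ']
    nlinarith
  calc W + Q + S ≤ _ := h1
    _ ≤ _ := h2
    _ ≤ (((K + 1) * (2 * N) + 1) / Pinf + 2 * (K + 1) / lam) * ((-(E w)) / (1 - Ξ)) :=
        mul_le_mul_of_nonneg_left h3 (by positivity)
    _ = _ := by ring
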